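/- arXiv:2201.04776 — 3 statements merged into one kernel-verified Lean document; each statement's English description precedes it below -/
import Mathlib

section
/- Let m be a positive integer, q ∈ (1, m+1], and x ∈ I_q := [0, m/(q−1)]. Suppose x has two different q-expansions (a_i) and (b_i) with respect to Ω_m such that a_1⋯a_{k−1} = b_1⋯b_{k−1} and b_k = a_k + d with d ≥ 2, for some k ≥ 1. Then for every integer n with 1 ≤ n ≤ d−1, x has a q-expansion whose first k digits are a_1⋯a_{k−1}(a_k+n). -/
/-- A sequence of digits has a last nonzero digit. -/
def hasLastNonzero (c : ℕ → ℕ) : Prop := ∃ n, c n ≠ 0 ∧ ∀ i > n, c i = 0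

/-- `c` (with `c i` the `(i+1)`-st digit) is a `q`-expansion of `x`
with respect to the digit set `Ω_m = {0,1,…,m}`. -/
def isExpansion (m : ℕ) (q : ℝ) (x : ℝ) (c : ℕ → ℕ) : Prop :=
  (∀ i, c i ≤ m) ∧ x = ∑' i : ℕ, (c i : ℝ) / q ^ (i + 1)

/-- The set `U_q` of points of `I_q = [0, m/(q-1)]` with a unique `q`-expansion. -/
def Uq (m : ℕ) (q : ℝ) : Set ℝ :=
  {x | x ∈ Set.Icc 0 ((m : ℝ) / (q - 1)) ∧ ∃! c, isExpansion m q x c}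

/-- The set `U'_q` of digit sequences that are unique `q`-expansions. -/
def Uq' (m : ℕ) (q : ℝ) : Set (ℕ → ℕ) :=
  {c | isExpansion m q (∑' i : ℕ, (c i : ℝ) / q ^ (i + 1)) c ∧
       ∀ d, isExpansion m q (∑' i : ℕ, (c i : ℝ) / q ^ (i + 1)) d → d = c}

/-- `B_2(m)`: bases `q ∈ (1, m+1]` for which some `x ∈ I_q` has exactly two
different `q`-expansions. -/
def B2 (m : ℕ) : Set ℝ :=
  {q | q ∈ Set.Ioc 1 ((m : ℝ) + 1) ∧
    ∃ x ∈ Set.Icc (0 : ℝ) ((m : ℝ) / (q - 1)), ∃ a b : ℕ → ℕ,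
      a ≠ b ∧ isExpansion m q x a ∧ isExpansion m q x b ∧
      ∀ c, isExpansion m q x c → c = a ∨ c = b}

/-- Strict lexicographic order on digit sequences. -/
def lexLt (a b : ℕ → ℕ) : Prop := ∃ n, (∀ i < n, a i = b i) ∧ a n < b n

/-- Lexicographic order on digit sequences. -/
def lexLe (a b : ℕ → ℕ) : Prop := lexLt a b ∨ a = b

/-- `a` is the quasi-greedy `q`-expansion of `1`: the lexicographically largest
`q`-expansion of `1` without a last nonzero digit. -/
def isQuasiGreedy (m : ℕ) (q : ℝ) (a : ℕ → ℕ) : Prop :=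
  isExpansion m q 1 a ∧ ¬ hasLastNonzero a ∧
  ∀ b, isExpansion m q 1 b → ¬ hasLastNonzero b → lexLe b a

/-- `A'_q = {(c_i) ∈ U'_q : c_1 < α_1(q)}`. -/
def Aq' (m : ℕ) (q : ℝ) : Set (ℕ → ℕ) :=
  {c | c ∈ Uq' m q ∧ ∀ a, isQuasiGreedy m q a → c 0 < a 0}

/-- `f_{c,d}(t) = (m+1)/t + Σ_{i≥1} (c_i + d_i) t^{-(i+1)} - m/(t-1)`. -/
noncomputable def fcd (m : ℕ) (c d : ℕ → ℕ) (t : ℝ) : ℝ :=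
  ((m : ℝ) + 1) / t + (∑' i : ℕ, ((c i : ℝ) + (d i : ℝ)) / t ^ (i + 2)) - (m : ℝ) / (t - 1)

/-- `x = q_f(m)`: the largest real root of `q³-(k+2)q²+q-(k+1)=0` if `m = 2k+1`,
and of `q²-(k+1)q-k=0` if `m = 2k`. -/
def isQf (m : ℕ) (x : ℝ) : Prop :=
  (∃ k : ℕ, m = 2 * k + 1 ∧
    x ^ 3 - ((k : ℝ) + 2) * x ^ 2 + x - ((k : ℝ) + 1) = 0 ∧
    ∀ y : ℝ, y ^ 3 - ((k : ℝ) + 2) * y ^ 2 + y - ((k : ℝ) + 1) = 0 → y ≤ x) ∨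
  (∃ k : ℕ, m = 2 * k ∧
    x ^ 2 - ((k : ℝ) + 1) * x - (k : ℝ) = 0 ∧
    ∀ y : ℝ, y ^ 2 - ((k : ℝ) + 1) * y - (k : ℝ) = 0 → y ≤ x)

/-- A doubly infinite sequence: neither it nor its reflection has a last nonzero digit. -/
def doublyInfinite (m : ℕ) (c : ℕ → ℕ) : Prop :=
  ¬ hasLastNonzero c ∧ ¬ hasLastNonzero (fun i => m - c i)

/-- `V_q`: points of `I_q` with at most one doubly infinite `q`-expansion. -/
def Vq (m : ℕ) (q : ℝ) : Set ℝ :=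
  {x | x ∈ Set.Icc 0 ((m : ℝ) / (q - 1)) ∧
    ∀ a b : ℕ → ℕ, isExpansion m q x a → isExpansion m q x b →
      doublyInfinite m a → doublyInfinite m b → a = b}

/-- `U = {q ∈ (1, m+1] : 1 ∈ U_q}`. -/
def Uset (m : ℕ) : Set ℝ := {q | q ∈ Set.Ioc 1 ((m : ℝ) + 1) ∧ (1 : ℝ) ∈ Uq m q}

/-- `V = {q ∈ (1, m+1] : 1 ∈ V_q}`. -/
def Vset (m : ℕ) : Set ℝ := {q | q ∈ Set.Ioc 1 ((m : ℝ) + 1) ∧ (1 : ℝ) ∈ Vq m q}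

/-- The generalized golden ratio `G(m)`. -/
noncomputable def Gratio (m : ℕ) : ℝ :=
  if m % 2 = 0 then ((m / 2 : ℕ) : ℝ) + 1
  else (((m / 2 : ℕ) : ℝ) + 1 +
    Real.sqrt (((m / 2 : ℕ) : ℝ) ^ 2 + 6 * ((m / 2 : ℕ) : ℝ) + 5)) / 2

/-- The set of accumulation points of a set of reals. -/
def accPts (S : Set ℝ) : Set ℝ := {x | AccPt x (Filter.principal S)}

/-- Iterated accumulation-point sets `B_2^{(i)}(m)`. -/
def B2iter (m : ℕ) : ℕ → Set ℝ
  | 0 => B2 m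
  | n + 1 => accPts (B2iter m n)

lemma summable_digits {m : ℕ} {q : ℝ} (hq : 1 < q) {c : ℕ → ℕ} (hc : ∀ i, c i ≤ m) :
    Summable fun i : ℕ => (c i : ℝ) / q ^ (i + 1) := by
  have hgeo : Summable fun i : ℕ => (m : ℝ) * (1 / q) ^ (i + 1) :=
    ((summable_nat_add_iff 1).2
      (summable_geometric_of_lt_one (by positivity) ((div_lt_one (by linarith)).2 hq))).mul_left _
  refine Summable.of_nonneg_of_le (fun i => by positivity) (fun i => ?_) hgeo
  rw [one_div, inv_pow, ← div_eq_mul_inv]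
  have := hc i
  gcongr

lemma tsum_digits_eq_sum_add {m : ℕ} {q : ℝ} (hq : 1 < q) {c : ℕ → ℕ} (hc : ∀ i, c i ≤ m)
    (k : ℕ) :
    ∑' i : ℕ, (c i : ℝ) / q ^ (i + 1) =
      ∑ i ∈ Finset.range k, (c i : ℝ) / q ^ (i + 1) +
        (∑' i : ℕ, (c (i + k) : ℝ) / q ^ (i + 1)) / q ^ k := by
  rw [← (summable_digits hq hc).sum_add_tsum_nat_add k, ← tsum_div_const]
  congr 2
  funext i
  rw [div_div, ← pow_add]
  congr 2
  ring

lemma tsum_digits_le {m : ℕ} {q : ℝ} (hq : 1 < q) {c : ℕ → ℕ} (hc : ∀ i, c i ≤ m) :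
    ∑' i : ℕ, (c i : ℝ) / q ^ (i + 1) ≤ m / (q - 1) := by
  have hle : ∑' i : ℕ, (c i : ℝ) / q ^ (i + 1) ≤ ∑' i : ℕ, (m : ℝ) / q ^ (i + 1) := by
    refine (summable_digits hq hc).tsum_le_tsum (fun i => ?_)
      (summable_digits hq (c := fun _ => m) fun _ => le_rfl)
    have := hc i
    gcongr
  have hself := tsum_digits_eq_sum_add hq (c := fun _ => m) (fun _ => le_rfl) 1
  simp only [Finset.sum_range_one, zero_add, pow_one] at hself
  refine hle.trans ((le_div_iff₀ (by linarith)).2 (le_of_eq ?_))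
  have hq0 : q ≠ 0 := by linarith
  field_simp at hself
  linarith

/-- The remainders of the greedy digit algorithm in base `q` started at `y`. -/
noncomputable def greedyRemainder (m : ℕ) (q y : ℝ) : ℕ → ℝ
  | 0 => y
  | n + 1 => q * greedyRemainder m q y n - (min m ⌊q * greedyRemainder m q y n⌋₊ : ℕ)

lemma greedyRemainder_mem_Icc {m : ℕ} {q y : ℝ} (hq : q ∈ Set.Ioc 1 ((m : ℝ) + 1))
    (hy : y ∈ Set.Icc 0 ((m : ℝ) / (q - 1))) (n : ℕ) :
    greedyRemainder m q y n ∈ Set.Icc 0 ((m : ℝ) / (q - 1)) := by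
  obtain ⟨hq1, hqm⟩ := hq
  induction n with
  | zero => exact hy
  | succ n ih =>
    obtain ⟨h0, h1⟩ := ih
    rw [greedyRemainder]
    set r := greedyRemainder m q y n
    have hqr : 0 ≤ q * r := by positivity
    have hfl := Nat.floor_le hqr
    have hlt := Nat.lt_floor_add_one (q * r)
    have hpos : 0 < q - 1 := by linarith
    rcases le_total m ⌊q * r⌋₊ with h | h
    · rw [min_eq_left h]
      have hcast : (m : ℝ) ≤ ⌊q * r⌋₊ := by exact_mod_cast h
      refine ⟨by linarith, ?_⟩
      rw [le_div_iff₀ hpos] at h1 ⊢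
      nlinarith
    · rw [min_eq_right h]
      have hone : 1 ≤ (m : ℝ) / (q - 1) := (one_le_div hpos).2 (by linarith)
      exact ⟨by linarith, by linarith⟩

lemma exists_isExpansion {m : ℕ} {q y : ℝ} (hq : q ∈ Set.Ioc 1 ((m : ℝ) + 1))
    (hy : y ∈ Set.Icc 0 ((m : ℝ) / (q - 1))) : ∃ c, isExpansion m q y c := by
  have hq1 : 1 < q := hq.1
  have hq0 : q ≠ 0 := by linarith
  set c : ℕ → ℕ := fun n => min m ⌊q * greedyRemainder m q y n⌋₊ with hc
  have hcm : ∀ i, c i ≤ m := fun i => min_le_left _ _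
  refine ⟨c, hcm, ?_⟩
  have hsum : ∀ n, ∑ i ∈ Finset.range n, (c i : ℝ) / q ^ (i + 1) =
      y - greedyRemainder m q y n / q ^ n := by
    intro n
    induction n with
    | zero => simp [greedyRemainder]
    | succ n ih =>
      rw [Finset.sum_range_succ, ih, greedyRemainder]
      simp only [hc]
      field_simp
      ring
  have hpow : Filter.Tendsto (fun n : ℕ => (m : ℝ) / (q - 1) / q ^ n) Filter.atTop (nhds 0) :=
    (tendsto_pow_atTop_atTop_of_one_lt hq1).const_div_atTop _
  have hrem : Filter.Tendsto (fun n => greedyRemainder m q y n / q ^ n)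
      Filter.atTop (nhds 0) := by
    refine squeeze_zero (fun n => ?_) (fun n => ?_) hpow
    · have := (greedyRemainder_mem_Icc hq hy n).1
      positivity
    · have := (greedyRemainder_mem_Icc hq hy n).2
      gcongr
  have hlim := (summable_digits hq1 hcm).hasSum.tendsto_sum_nat
  simp only [hsum] at hlim
  refine tendsto_nhds_unique ?_ hlim
  simpa using hrem.const_sub y

/-- If `x` has two `q`-expansions agreeing up to digit `k-1` and
differing by `d ≥ 2` at digit `k`, then for every `1 ≤ n ≤ d-1` it also has a
`q`-expansion starting with `a_1 ⋯ a_{k-1}(a_k + n)`. -/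
theorem stmt0 (m : ℕ) (hm : 0 < m) (q : ℝ) (hq : q ∈ Set.Ioc 1 ((m : ℝ) + 1))
    (x : ℝ) (hx : x ∈ Set.Icc (0 : ℝ) ((m : ℝ) / (q - 1)))
    (a b : ℕ → ℕ) (hab : a ≠ b)
    (ha : isExpansion m q x a) (hb : isExpansion m q x b)
    (k d : ℕ) (hk : 1 ≤ k) (hd : 2 ≤ d)
    (hpre : ∀ i < k - 1, a i = b i) (hbk : b (k - 1) = a (k - 1) + d) :
    ∀ n, 1 ≤ n → n ≤ d - 1 →
      ∃ c : ℕ → ℕ, isExpansion m q x c ∧ (∀ i < k - 1, c i = a i) ∧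
        c (k - 1) = a (k - 1) + n := by
  intro n hn hnd
  obtain ⟨k, rfl⟩ : ∃ j, k = j + 1 := ⟨k - 1, by omega⟩
  simp only [Nat.add_sub_cancel] at *
  have hq1 : 1 < q := hq.1
  have hpow : (0 : ℝ) < q ^ (k + 1) := by positivity
  obtain ⟨ham, hax⟩ := ha
  obtain ⟨hbm, hbx⟩ := hb
  have hsa := tsum_digits_eq_sum_add hq1 ham (k + 1)
  have hsb := tsum_digits_eq_sum_add hq1 hbm (k + 1)
  rw [← hax, Finset.sum_range_succ] at hsa
  rw [← hbx, Finset.sum_range_succ, hbk] at hsb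
  have hpresum : ∑ i ∈ Finset.range k, (a i : ℝ) / q ^ (i + 1) =
      ∑ i ∈ Finset.range k, (b i : ℝ) / q ^ (i + 1) :=
    Finset.sum_congr rfl fun i hi => by rw [hpre i (Finset.mem_range.1 hi)]
  have hya := tsum_digits_le hq1 fun i => ham (i + (k + 1))
  have hyb : 0 ≤ ∑' i : ℕ, (b (i + (k + 1)) : ℝ) / q ^ (i + 1) :=
    tsum_nonneg fun i => by positivity
  set ya := ∑' i : ℕ, (a (i + (k + 1)) : ℝ) / q ^ (i + 1)
  set yb := ∑' i : ℕ, (b (i + (k + 1)) : ℝ) / q ^ (i + 1)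
  have hyab : ya = yb + d := by
    have h : (a k : ℝ) / q ^ (k + 1) + ya / q ^ (k + 1) =
        ((a k + d : ℕ) : ℝ) / q ^ (k + 1) + yb / q ^ (k + 1) := by linarith
    rw [← add_div, ← add_div, div_left_inj' hpow.ne'] at h
    push_cast at h
    linarith
  have hnd' : (n : ℝ) ≤ d := by exact_mod_cast hnd.trans (Nat.sub_le d 1)
  have hn0 : (0 : ℝ) ≤ n := n.cast_nonneg
  obtain ⟨e, hem, hey⟩ := exists_isExpansion hq (y := ya - n) ⟨by linarith, by linarith⟩
  set c : ℕ → ℕ := fun i => if i < k then a i else if i = k then a k + n else e (i - (k + 1))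
    with hc
  have hck : c k = a k + n := by simp [hc]
  have hclt : ∀ i < k, c i = a i := fun i hi => by simp [hc, hi]
  have hctail : ∀ i, c (i + (k + 1)) = e i := fun i => by
    simp [hc, show ¬ i + (k + 1) < k by omega, show i + (k + 1) ≠ k by omega]
  have hcm : ∀ i, c i ≤ m := by
    intro i
    have := hbm k
    simp only [hc]
    split_ifs
    · exact ham i
    · omega
    · exact hem _
  refine ⟨c, ⟨hcm, ?_⟩, hclt, hck⟩
  rw [tsum_digits_eq_sum_add hq1 hcm (k + 1), Finset.sum_range_succ, hck,
    Finset.sum_congr rfl fun i hi => by rw [hclt i (Finset.mem_range.1 hi)]]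
  simp only [hctail]
  rw [← hey, hsa]
  push_cast
  ring
end

section
/- Let m = 2k+1 be an odd positive integer, let q ∈ [q_f(m), m+1], and let c, d ∈ A'_q. If f_{c,d}(q) ≤ 0, then the function t ↦ f_{c,d}(t) is strictly increasing on [q, m+1]. -/
open Set

/-- If the cubic defining `q_f` is negative at `s ≤ k + 2`, then `s` lies below its largest root. -/
lemma lt_of_cubic_neg {k : ℕ} {qf s : ℝ}
    (hqf : ∀ y : ℝ, y ^ 3 - ((k : ℝ) + 2) * y ^ 2 + y - ((k : ℝ) + 1) = 0 → y ≤ qf)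
    (hs : s ≤ k + 2) (hneg : s ^ 3 - ((k : ℝ) + 2) * s ^ 2 + s - ((k : ℝ) + 1) < 0) :
    s < qf := by
  have hcont : ContinuousOn
      (fun y : ℝ => y ^ 3 - ((k : ℝ) + 2) * y ^ 2 + y - ((k : ℝ) + 1)) (Icc s (k + 2)) := by
    fun_prop
  obtain ⟨z, hz, hz0⟩ := intermediate_value_Icc hs hcont
    (show (0 : ℝ) ∈ Icc _ _ from ⟨hneg.le, by ring_nf; norm_num⟩)
  have hsz : s ≠ z := by
    rintro rfl
    exact hneg.ne hz0
  exact (lt_of_le_of_ne hz.1 hsz).trans_le (hqf z hz0)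

lemma add_three_fourths_lt {k : ℕ} {qf : ℝ}
    (hqf : ∀ y : ℝ, y ^ 3 - ((k : ℝ) + 2) * y ^ 2 + y - ((k : ℝ) + 1) = 0 → y ≤ qf) :
    (k : ℝ) + 7 / 4 < qf := by
  have hk : (0 : ℝ) ≤ k := k.cast_nonneg
  refine lt_of_cubic_neg hqf (by linarith) ?_
  nlinarith

lemma add_two_sub_inv_lt {k : ℕ} {qf : ℝ}
    (hqf : ∀ y : ℝ, y ^ 3 - ((k : ℝ) + 2) * y ^ 2 + y - ((k : ℝ) + 1) = 0 → y ≤ qf) :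
    (k : ℝ) + 2 - 1 / (k + 3) < qf := by
  have hk : (0 : ℝ) ≤ k := k.cast_nonneg
  have hδ : (0 : ℝ) < 1 / (k + 3) := by positivity
  refine lt_of_cubic_neg hqf (by linarith) ?_
  have hδ1 : 1 / ((k : ℝ) + 3) * (k + 3) = 1 := by field_simp
  have hδ2 : 1 / ((k : ℝ) + 3) ≤ 1 / 3 := by gcongr; linarith
  generalize 1 / ((k : ℝ) + 3) = δ at *
  have h1 : (k : ℝ) + 5 / 3 ≤ k + 2 - δ := by linarith
  have h2 : ((k : ℝ) + 5 / 3) ^ 2 ≤ (k + 2 - δ) ^ 2 := by gcongr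
  nlinarith [mul_le_mul_of_nonneg_left h2 hδ.le, mul_nonneg hδ.le hk,
    mul_nonneg hδ.le (mul_nonneg hk hk)]

section Series

variable {e : ℕ → ℝ} {M : ℝ}

lemma summable_bounded_mul_pow (he : ∀ n, |e n| ≤ M) {x : ℝ} (hx : |x| < 1) (a : ℕ) :
    Summable fun n => e n * x ^ (n + a) := by
  refine Summable.of_norm_bounded
    (((summable_geometric_of_lt_one (abs_nonneg x) hx).mul_left (M * |x| ^ a))) fun n => ?_
  rw [Real.norm_eq_abs, abs_mul, abs_pow, pow_add, mul_assoc, mul_comm (|x| ^ a)]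
  exact mul_le_mul_of_nonneg_right (he n) (by positivity)

lemma summable_succ_mul_pow {r : ℝ} (hr0 : 0 ≤ r) (hr : r < 1) :
    Summable fun n : ℕ => ((n : ℝ) + 2) * r ^ (n + 1) := by
  have h1 := (summable_pow_mul_geometric_of_norm_lt_one 1
    (show ‖r‖ < 1 by rwa [Real.norm_of_nonneg hr0])).mul_left r
  have h2 := (summable_geometric_of_lt_one hr0 hr).mul_left (2 * r)
  refine (h1.add h2).congr fun n => ?_
  ring

lemma summable_deriv_terms (he : ∀ n, |e n| ≤ M) {x : ℝ} (hx0 : 0 ≤ x) (hx : x < 1) :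
    Summable fun n : ℕ => e n * (((n : ℝ) + 2) * x ^ (n + 1)) := by
  refine Summable.of_norm_bounded ((summable_succ_mul_pow hx0 hx).mul_left M) fun n => ?_
  rw [Real.norm_eq_abs, abs_mul, abs_of_nonneg (by positivity : 0 ≤ ((n : ℝ) + 2) * x ^ (n + 1))]
  exact mul_le_mul_of_nonneg_right (he n) (by positivity)

lemma hasDerivAt_tsum_mul_pow (he : ∀ n, |e n| ≤ M) {x : ℝ} (hx : |x| < 1) :
    HasDerivAt (fun z => ∑' n, e n * z ^ (n + 2))
      (∑' n : ℕ, e n * (((n : ℝ) + 2) * x ^ (n + 1))) x := by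
  obtain ⟨r, hxr, hr⟩ := exists_between hx
  have hr0 : 0 < r := (abs_nonneg x).trans_lt hxr
  refine hasDerivAt_tsum_of_isPreconnected (𝕜 := ℝ) (F := ℝ) (t := Metric.ball (0 : ℝ) r) (y₀ := 0)
    (u := fun n : ℕ => M * (((n : ℝ) + 2) * r ^ (n + 1)))
    (g := fun n z => e n * z ^ (n + 2))
    (g' := fun n z => e n * (((n : ℝ) + 2) * z ^ (n + 1)))
    ((summable_succ_mul_pow hr0.le hr).mul_left M)
    Metric.isOpen_ball (convex_ball (0 : ℝ) r).isPreconnected (fun n z _ => ?_) (fun n z hz => ?_)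
    (Metric.mem_ball_self hr0) ?_ (by simpa using hxr)
  · have := (hasDerivAt_pow (n + 2) z).const_mul (e n)
    simpa using this
  · have hz' : |z| ≤ r := by
      have := mem_ball_zero_iff.1 hz
      rw [Real.norm_eq_abs] at this
      exact this.le
    rw [Real.norm_eq_abs, abs_mul, abs_mul, abs_pow,
      abs_of_nonneg (by positivity : (0 : ℝ) ≤ (n : ℝ) + 2)]
    have : 0 ≤ M := (abs_nonneg _).trans (he n)
    gcongr
    exact he n
  · exact summable_bounded_mul_pow he (by simp) 2

/-- A nonpositive value of `1 + ∑ eₙ yⁿ⁺¹` bounds the leading coefficient from above. -/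
lemma leading_coeff_le (he : ∀ n, |e n| ≤ M) {y : ℝ} (hy0 : 0 ≤ y) (hy : y < 1)
    (h : 1 + ∑' n, e n * y ^ (n + 1) ≤ 0) :
    1 + e 0 * y ≤ M * y ^ 2 / (1 - y) := by
  have hs := summable_bounded_mul_pow he (by rwa [abs_of_nonneg hy0] : |y| < 1) 1
  have hlow : HasSum (fun n => -(M * y ^ 2) * y ^ n) (-(M * y ^ 2) * (1 - y)⁻¹) :=
    (hasSum_geometric_of_lt_one hy0 hy).mul_left _
  rw [hs.tsum_eq_zero_add] at h
  have hle := hasSum_le (fun n => ?_) hlow ((summable_nat_add_iff 1).2 hs).hasSum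
  · rw [div_eq_mul_inv]
    simp only [zero_add, pow_one] at h
    linarith
  · have := (abs_le.1 (he (n + 1))).1
    have hp : 0 ≤ y ^ (n + 1 + 1) := by positivity
    calc -(M * y ^ 2) * y ^ n = -M * y ^ (n + 1 + 1) := by ring
      _ ≤ _ := mul_le_mul_of_nonneg_right this hp

lemma abs_succ_mul_pow_sub_le {ρ : ℝ} (hρ : 1 / 2 ≤ ρ) (hρ1 : ρ ≤ 1) (n : ℕ) :
    |((n : ℝ) + 3) * ρ ^ n - 3| ≤ n := by
  have hp1 : ρ ^ n ≤ 1 := pow_le_one₀ (by linarith) hρ1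
  have hp0 : 0 ≤ ρ ^ n := by positivity
  have hn : (0 : ℝ) ≤ n := n.cast_nonneg
  rw [abs_le]
  constructor
  · match n with
    | 0 => norm_num
    | 1 => norm_num; linarith
    | 2 => norm_num; nlinarith
    | l + 3 =>
      push_cast at hn ⊢
      have : (0 : ℝ) ≤ l := l.cast_nonneg
      have : 0 ≤ ((l : ℝ) + 3 + 3) * ρ ^ (l + 3) := by positivity
      linarith
  · nlinarith

/-- Upper bound at `ρ y` for the derivative of `x + ∑ eₙ xⁿ⁺²`, a function nonpositive at `y`. -/
lemma deriv_series_le (he : ∀ n, |e n| ≤ M) {y ρ : ℝ} (hy0 : 0 ≤ y) (hy : y < 1)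
    (hρ : 1 / 2 ≤ ρ) (hρ1 : ρ ≤ 1) (h : 1 + ∑' n, e n * y ^ (n + 1) ≤ 0) :
    1 + ∑' n : ℕ, e n * (((n : ℝ) + 2) * (ρ * y) ^ (n + 1)) ≤
      1 - 3 * ρ ^ 2 + e 0 * y * (2 * ρ - 3 * ρ ^ 2) + M * ρ ^ 2 * (y ^ 3 / (1 - y) ^ 2) := by
  have hx0 : 0 ≤ ρ * y := by positivity
  have hx : ρ * y < 1 := by nlinarith
  have hsy := summable_bounded_mul_pow he (by rwa [abs_of_nonneg hy0] : |y| < 1) 1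
  have hsx := summable_deriv_terms he hx0 hx
  have hM : 0 ≤ M := (abs_nonneg _).trans (he 0)
  have hsF := hsx.sub (hsy.mul_left (3 * ρ ^ 2))
  have hF := hsx.tsum_sub (hsy.mul_left (3 * ρ ^ 2))
  rw [tsum_mul_left, hsF.tsum_eq_zero_add] at hF
  have hup : HasSum (fun n : ℕ => M * ρ ^ 2 * y ^ 2 * (n * y ^ n))
      (M * ρ ^ 2 * y ^ 2 * (y / (1 - y) ^ 2)) :=
    (hasSum_coe_mul_geometric_of_norm_lt_one
      (by rwa [Real.norm_of_nonneg hy0] : ‖y‖ < 1)).mul_left _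
  have hle := hasSum_le (fun n => ?_) ((summable_nat_add_iff 1).2 hsF).hasSum hup
  · have h3 : 3 * ρ ^ 2 * (1 + ∑' n, e n * y ^ (n + 1)) ≤ 0 :=
      mul_nonpos_of_nonneg_of_nonpos (by positivity) h
    have e1 : M * ρ ^ 2 * y ^ 2 * (y / (1 - y) ^ 2) = M * ρ ^ 2 * (y ^ 3 / (1 - y) ^ 2) := by ring
    simp only [Nat.cast_zero, zero_add, pow_one] at hF
    linarith
  · have hb := abs_succ_mul_pow_sub_le hρ hρ1 n
    have hprod : e (n + 1) * (((n : ℝ) + 3) * ρ ^ n - 3) ≤ M * n :=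
      (le_abs_self _).trans (by rw [abs_mul]; exact mul_le_mul (he _) hb (abs_nonneg _) hM)
    have hw : 0 ≤ ρ ^ 2 * y ^ 2 * y ^ n := by positivity
    have := mul_le_mul_of_nonneg_right hprod hw
    push_cast
    calc _ = e (n + 1) * (((n : ℝ) + 3) * ρ ^ n - 3) * (ρ ^ 2 * y ^ 2 * y ^ n) := by
          rw [mul_pow]; ring
      _ ≤ _ := this
      _ = _ := by ring

end Series

/-- The sum defining `fcd` as a power series in `t⁻¹`. -/
lemma fcd_eq {m : ℕ} {c d : ℕ → ℕ} (hc : ∀ i, c i ≤ m) (hd : ∀ i, d i ≤ m) {t : ℝ} (ht : 1 < t) :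
    fcd m c d t = t⁻¹ + ∑' n, ((c n : ℝ) + d n - m) * t⁻¹ ^ (n + 2) := by
  have ht0 : 0 < t := by linarith
  have hi0 : 0 ≤ t⁻¹ := by positivity
  have hi1 : t⁻¹ < 1 := inv_lt_one_of_one_lt₀ ht
  have hs : Summable fun n => ((c n : ℝ) + d n) * t⁻¹ ^ (n + 2) := by
    refine summable_bounded_mul_pow (M := m + m) (fun n => ?_) (by rwa [abs_of_nonneg hi0]) 2
    rw [abs_of_nonneg (by positivity)]
    exact_mod_cast Nat.add_le_add (hc n) (hd n)
  have hg : HasSum (fun n => (m : ℝ) * t⁻¹ ^ 2 * t⁻¹ ^ n) (m * t⁻¹ ^ 2 * (1 - t⁻¹)⁻¹) :=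
    (hasSum_geometric_of_lt_one hi0 hi1).mul_left _
  have hsub := (hs.hasSum.sub hg).tsum_eq
  have e1 : (fun n => ((c n : ℝ) + d n - m) * t⁻¹ ^ (n + 2)) =
      fun n => ((c n : ℝ) + d n) * t⁻¹ ^ (n + 2) - (m : ℝ) * t⁻¹ ^ 2 * t⁻¹ ^ n := by
    funext n; ring
  rw [e1, hsub, fcd]
  have e2 : (fun n => ((c n : ℝ) + d n) / t ^ (n + 2)) =
      fun n => ((c n : ℝ) + d n) * t⁻¹ ^ (n + 2) := by
    funext n; rw [inv_pow, div_eq_mul_inv]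
  have ht1 : t - 1 ≠ 0 := by linarith
  have e3 : (1 - t⁻¹)⁻¹ = t / (t - 1) := by
    rw [show 1 - t⁻¹ = (t - 1) / t by field_simp, inv_div]
  rw [e2, e3]
  field_simp
  ring

/-- The bound of `leading_coeff_le` at `y = q⁻¹`, with `e 0 = -j`, forces `j ≥ k + 1`. -/
lemma leading_digit_ge {k j : ℕ} {q : ℝ} (hq : (k : ℝ) + 2 - 1 / (k + 3) < q)
    (hj : 1 - j * q⁻¹ ≤ (2 * k + 1) * q⁻¹ ^ 2 / (1 - q⁻¹)) : k + 1 ≤ j := by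
  by_contra! hlt
  have hjk : (j : ℝ) ≤ k := by exact_mod_cast Nat.le_of_lt_succ hlt
  have hk : (0 : ℝ) ≤ k := k.cast_nonneg
  have hδ2 : 1 / ((k : ℝ) + 3) ≤ 1 / 3 := by gcongr; linarith
  have hδ1 : 1 / ((k : ℝ) + 3) * (k + 3) = 1 := by field_simp
  generalize 1 / ((k : ℝ) + 3) = δ at *
  have hq1 : 0 < q - 1 := by linarith
  have hq0 : 0 < q := by linarith
  have e1 : (2 * (k : ℝ) + 1) * q⁻¹ ^ 2 / (1 - q⁻¹) = (2 * k + 1) / (q * (q - 1)) := by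
    have : 1 - q⁻¹ = (q - 1) / q := by field_simp
    rw [this]
    field_simp
  have e2 : 1 - j * q⁻¹ = (q - j) / q := by field_simp
  rw [e1, e2, div_le_div_iff₀ hq0 (by positivity)] at hj
  have h1 : (q - j) * (q - 1) ≤ 2 * k + 1 := by
    refine le_of_mul_le_mul_right ?_ hq0
    linarith
  have h2 : (2 - δ) * (k + 1 - δ) < (q - j) * (q - 1) := by
    apply mul_lt_mul'' <;> linarith
  nlinarith [sq_nonneg δ]

/-- Negativity of the bound of `deriv_series_le`, with `e 0 = -j`, `y = q⁻¹` and `ρ = q / t`. -/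
lemma deriv_bound_neg {k : ℕ} {j q t : ℝ} (hq : (k : ℝ) + 7 / 4 < q) (hqt : q ≤ t)
    (ht : t ≤ 2 * k + 2) (hj : (k : ℝ) + 1 ≤ j) (hjm : j ≤ 2 * k + 1) :
    1 - 3 * (q / t) ^ 2 + -j * q⁻¹ * (2 * (q / t) - 3 * (q / t) ^ 2) +
      (2 * k + 1) * (q / t) ^ 2 * (q⁻¹ ^ 3 / (1 - q⁻¹) ^ 2) < 0 := by
  have hk : (0 : ℝ) ≤ k := k.cast_nonneg
  have hq0 : 0 < q := by linarith
  have hq1 : 0 < q - 1 := by linarith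
  have ht0 : 0 < t := by linarith
  have hw : (2 * (k : ℝ) + 1) / (q - 1) ^ 2 < 2 := by
    rw [div_lt_iff₀ (by positivity)]
    nlinarith
  set A := (2 * (k : ℝ) + 1) / (q - 1) ^ 2 / q with hA
  have hAq : A * q < 2 := by rw [hA, div_mul_cancel₀ _ hq0.ne']; exact hw
  have eA : (2 * (k : ℝ) + 1) * (q / t) ^ 2 * (q⁻¹ ^ 3 / (1 - q⁻¹) ^ 2) = A * (q / t) ^ 2 := by
    rw [hA, show 1 - q⁻¹ = (q - 1) / q by field_simp]
    field_simp
  set ρ := q / t with hρ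
  have hρ0 : 0 < ρ := by positivity
  have hρ1 : ρ ≤ 1 := (div_le_one ht0).2 hqt
  have hρq : q ≤ ρ * (2 * k + 2) := by
    calc q = ρ * t := by rw [hρ]; field_simp
      _ ≤ _ := by gcongr
  set u := j * q⁻¹ with hu
  have huq : u * q = j := by rw [hu]; field_simp
  have hux : 1 / 2 ≤ u * ρ := by
    have : u * ρ = j / t := by rw [hu, hρ]; field_simp
    rw [this, le_div_iff₀ ht0]
    linarith
  have hu2 : u + A < 2 := by
    refine lt_of_mul_lt_mul_right ?_ hq0.le
    rw [add_mul, huq]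
    linarith
  rw [eA, neg_mul, ← hu]
  suffices 1 - 2 * (u * ρ) + ρ ^ 2 * (3 * u + A - 3) < 0 by linarith
  rcases lt_or_ge (3 * u + A - 3) 0 with hC | hC
  · nlinarith [mul_pos_of_neg_of_neg hC (by nlinarith : -ρ ^ 2 < 0)]
  rcases le_or_gt ρ (2 / 3) with h | h
  · have h1 : 3 / 2 < ρ * (3 - A) := by
      have : 3 * ((k : ℝ) + 1) < q * (3 - A) := by linarith
      have hA3 : 0 < 3 - A := by
        by_contra! hh
        nlinarith
      nlinarith [mul_le_mul_of_nonneg_right hρq hA3.le]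
    nlinarith [mul_nonneg (sub_nonneg.2 hux) (by linarith : 0 ≤ 2 - 3 * ρ), mul_pos hρ0 (sub_pos.2 h1)]
  · have hA34 : A < 3 / 4 := by
      rcases k.eq_zero_or_pos with rfl | hk1
      · push_cast at hq hjm
        have : u * q ≤ 1 := by linarith
        nlinarith
      · have : (1 : ℝ) ≤ k := by exact_mod_cast hk1
        nlinarith
    have hsq : ρ ^ 2 ≤ 5 / 3 * ρ - 2 / 3 := by nlinarith
    have h1 := mul_le_mul_of_nonneg_right hsq hC
    have h2 : (1 - ρ) * (4 / 3 * A - 1) ≤ 0 :=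
      mul_nonpos_of_nonneg_of_nonpos (by linarith) (by linarith)
    have h3 : (3 * ρ - 2) * (u + A - 2) < 0 := mul_neg_of_pos_of_neg (by linarith) (by linarith)
    linarith

/-- For odd `m = 2k+1`: if `f_{c,d}(q) ≤ 0` with
`q ∈ [q_f(m), m+1]` and `c, d ∈ A'_q`, then `f_{c,d}` is strictly
increasing on `[q, m+1]`. -/
theorem stmt8 (k m : ℕ) (hm : m = 2 * k + 1) (qf : ℝ)
    (hqf : qf ^ 3 - ((k : ℝ) + 2) * qf ^ 2 + qf - ((k : ℝ) + 1) = 0)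
    (hqf' : ∀ y : ℝ, y ^ 3 - ((k : ℝ) + 2) * y ^ 2 + y - ((k : ℝ) + 1) = 0 → y ≤ qf)
    (q : ℝ) (hq : q ∈ Set.Icc qf ((m : ℝ) + 1))
    (c d : ℕ → ℕ) (hc : c ∈ Aq' m q) (hd : d ∈ Aq' m q)
    (h0 : fcd m c d q ≤ 0) :
    StrictMonoOn (fcd m c d) (Set.Icc q ((m : ℝ) + 1)) := by
  
  subst hm
  rw [Nat.cast_add, Nat.cast_mul, Nat.cast_one, Nat.cast_ofNat] at hq ⊢
  have hk : (0 : ℝ) ≤ k := k.cast_nonneg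
  have hq1 := (add_three_fourths_lt hqf').trans_le hq.1
  have hq2 := (add_two_sub_inv_lt hqf').trans_le hq.1
  have hcm : ∀ i, c i ≤ 2 * k + 1 := hc.1.1.1
  have hdm : ∀ i, d i ≤ 2 * k + 1 := hd.1.1.1
  have hqpos : 1 < q := by linarith
  have hy0 : 0 < q⁻¹ := by positivity
  have hy1 : q⁻¹ < 1 := inv_lt_one_of_one_lt₀ hqpos
  set e : ℕ → ℝ := fun n => (c n : ℝ) + d n - (2 * k + 1 : ℕ) with he_def
  have he : ∀ n, |e n| ≤ 2 * k + 1 := fun n => by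
    have h1 : (c n : ℝ) ≤ 2 * k + 1 := by exact_mod_cast hcm n
    have h2 : (d n : ℝ) ≤ 2 * k + 1 := by exact_mod_cast hdm n
    have h3 : (0 : ℝ) ≤ c n := Nat.cast_nonneg _
    have h4 : (0 : ℝ) ≤ d n := Nat.cast_nonneg _
    simp only [he_def, abs_le]
    push_cast
    constructor <;> linarith
  have hfcd : ∀ t, 1 < t → fcd (2 * k + 1) c d t = t⁻¹ + ∑' n, e n * t⁻¹ ^ (n + 2) :=
    fun t ht => fcd_eq hcm hdm ht
  have hneg : 1 + ∑' n, e n * q⁻¹ ^ (n + 1) ≤ 0 := by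
    rw [hfcd q hqpos] at h0
    have : ∑' n, e n * q⁻¹ ^ (n + 2) = q⁻¹ * ∑' n, e n * q⁻¹ ^ (n + 1) := by
      rw [← tsum_mul_left]
      exact tsum_congr fun n => by ring
    rw [this] at h0
    refine nonpos_of_mul_nonpos_right ?_ hy0
    linarith
  have hlead := leading_coeff_le he hy0.le hy1 hneg
  have hsum : c 0 + d 0 ≤ k := by
    by_contra! hlt
    have h2 : -(k : ℝ) ≤ e 0 := by
      have : ((k + 1 : ℕ) : ℝ) ≤ ((c 0 + d 0 : ℕ) : ℝ) := by exact_mod_cast hlt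
      simp only [he_def]
      push_cast at this ⊢
      linarith
    have := leading_digit_ge (j := k) hq2 (by nlinarith)
    omega
  have hj1 : (k : ℝ) + 1 ≤ -e 0 := by
    have : ((c 0 + d 0 : ℕ) : ℝ) ≤ k := by exact_mod_cast hsum
    simp only [he_def]
    push_cast at this ⊢
    linarith
  have hj2 : -e 0 ≤ 2 * k + 1 := (neg_le_abs _).trans (he 0)
  have hderiv : ∀ t ∈ Icc q (2 * (k : ℝ) + 1 + 1), HasDerivAt
      (fun s : ℝ => s⁻¹ + ∑' n, e n * s⁻¹ ^ (n + 2))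
      ((1 + ∑' n : ℕ, e n * (((n : ℝ) + 2) * t⁻¹ ^ (n + 1))) * -(t ^ 2)⁻¹) t := fun t ht => by
    have ht1 : 1 < t := hqpos.trans_le ht.1
    have hti : |t⁻¹| < 1 := by
      rw [abs_of_pos (by positivity)]
      exact inv_lt_one_of_one_lt₀ ht1
    exact ((hasDerivAt_id (t⁻¹)).add (hasDerivAt_tsum_mul_pow he hti)).comp t
      (hasDerivAt_inv (by positivity))
  have hmono : StrictMonoOn (fun s : ℝ => s⁻¹ + ∑' n, e n * s⁻¹ ^ (n + 2))
      (Icc q (2 * (k : ℝ) + 1 + 1)) := by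
    refine strictMonoOn_of_hasDerivWithinAt_pos (convex_Icc _ _)
      (fun t ht => (hderiv t ht).continuousAt.continuousWithinAt)
      (fun t ht => (hderiv t (interior_subset ht)).hasDerivWithinAt) fun t ht => ?_
    obtain ⟨ht1, ht2⟩ := interior_subset ht
    have ht0 : 0 < t := by linarith
    have hρ : 1 / 2 ≤ q / t := by
      rw [le_div_iff₀ ht0]
      linarith
    have hρ1 : q / t ≤ 1 := (div_le_one ht0).2 ht1
    have hle := deriv_series_le he hy0.le hy1 hρ hρ1 hneg
    have hlt := deriv_bound_neg hq1 ht1 (by linarith) hj1 hj2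
    rw [neg_neg] at hlt
    rw [show q / t * q⁻¹ = t⁻¹ by field_simp] at hle
    exact mul_pos_of_neg_of_neg (hle.trans_lt hlt) (neg_neg_of_pos (by positivity))
  exact hmono.congr fun t ht => (hfcd t (hqpos.trans_le ht.1)).symm
end

section
/- Let m = 2k be an even positive integer, let q ∈ [q_f(m), m+1], and let c, d ∈ A'_q. If f_{c,d}(q) ≤ 0, then the function t ↦ f_{c,d}(t) is strictly increasing on [q, m+1]. -/
/-- The value `Σ a_i t^{-(i+1)}` of the digit sequence `a` in base `t`. -/
noncomputable def digitSum (a : ℕ → ℝ) (t : ℝ) : ℝ := ∑' i : ℕ, a i / t ^ (i + 1)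

theorem summable_digits_s9 {a : ℕ → ℝ} {M t : ℝ} (ht : 1 < t) (ha0 : ∀ i, 0 ≤ a i)
    (ha : ∀ i, a i ≤ M) : Summable fun i : ℕ => a i / t ^ (i + 1) := by
  have h0 : (0 : ℝ) < t := by linarith
  have hg : Summable fun i : ℕ => M * (1 / t) ^ (i + 1) :=
    ((summable_nat_add_iff 1).2
      (summable_geometric_of_lt_one (by positivity) ((div_lt_one h0).2 ht))).mul_left M
  refine Summable.of_nonneg_of_le (fun i => div_nonneg (ha0 i) (by positivity)) (fun i => ?_) hg
  rw [one_div, inv_pow, ← div_eq_mul_inv]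
  exact div_le_div_of_nonneg_right (ha i) (by positivity)

theorem digitSum_nonneg {a : ℕ → ℝ} {t : ℝ} (ht : 0 < t) (ha0 : ∀ i, 0 ≤ a i) :
    0 ≤ digitSum a t :=
  tsum_nonneg fun i => div_nonneg (ha0 i) (by positivity)

theorem digitSum_eq_shift {a : ℕ → ℝ} {M t : ℝ} (ht : 1 < t) (ha0 : ∀ i, 0 ≤ a i)
    (ha : ∀ i, a i ≤ M) : digitSum a t = (a 0 + digitSum (fun i => a (i + 1)) t) / t := by
  have h0 : (0 : ℝ) < t := by linarith
  unfold digitSum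
  rw [(summable_digits_s9 ht ha0 ha).tsum_eq_zero_add, add_div, ← tsum_div_const]
  congr 1
  · simp
  · refine tsum_congr fun i => ?_
    rw [div_div, ← pow_succ]

theorem digitSum_le_const {a : ℕ → ℝ} {M t : ℝ} (ht : 1 < t) (ha0 : ∀ i, 0 ≤ a i)
    (ha : ∀ i, a i ≤ M) : digitSum a t ≤ M / (t - 1) := by
  have h0 : (0 : ℝ) < t := by linarith
  have hM : 0 ≤ M := (ha0 0).trans (ha 0)
  have hle : digitSum a t ≤ digitSum (fun _ => M) t :=
    (summable_digits_s9 ht ha0 ha).tsum_le_tsum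
      (fun i => div_le_div_of_nonneg_right (ha i) (by positivity))
      (summable_digits_s9 ht (fun _ => hM) fun _ => le_rfl)
  have hs := digitSum_eq_shift (a := fun _ => M) ht (fun _ => hM) fun _ => le_rfl
  have : digitSum (fun _ => M) t = M / (t - 1) := by
    rw [eq_div_iff h0.ne'] at hs
    rw [eq_div_iff (by linarith)]
    linarith
  linarith

theorem digitSum_le_of_base_le {a : ℕ → ℝ} {M q t : ℝ} (hq : 1 < q) (hqt : q ≤ t)
    (ha0 : ∀ i, 0 ≤ a i) (ha : ∀ i, a i ≤ M) :
    digitSum a t ≤ q / t * digitSum a q := by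
  have h0 : (0 : ℝ) < q := by linarith
  have h1 : (0 : ℝ) < t := by linarith
  unfold digitSum
  rw [← tsum_mul_left]
  refine (summable_digits_s9 (hq.trans_le hqt) ha0 ha).tsum_le_tsum (fun i => ?_)
    ((summable_digits_s9 hq ha0 ha).mul_left _)
  have hp : q ^ i ≤ t ^ i := pow_le_pow_left₀ h0.le hqt i
  have : q / t * (a i / q ^ (i + 1)) = a i / (t * q ^ i) := by
    field_simp
    ring
  rw [this, pow_succ']
  exact div_le_div_of_nonneg_left (ha0 i) (by positivity)
    (mul_le_mul_of_nonneg_left hp h1.le)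

theorem sum_mul_digits_le {s τ : ℕ → ℝ} {B t : ℝ} (ht : 1 < t)
    (hrec : ∀ n, s n = t * τ n - τ (n + 1)) (hτ0 : ∀ n, 0 ≤ τ n) (hτ : ∀ n, τ (n + 1) ≤ B)
    (N : ℕ) : ∑ i ∈ Finset.range N, (i : ℝ) * (s i / t ^ (i + 1)) ≤ B / (t - 1) := by
  have h0 : (0 : ℝ) < t := by linarith
  have h1 : (0 : ℝ) < t - 1 := by linarith
  have hB : 0 ≤ B := (hτ0 1).trans (hτ 0)
  have key : ∀ N : ℕ, ∑ i ∈ Finset.range (N + 1), (i : ℝ) * (s i / t ^ (i + 1))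
      + N * τ (N + 1) / t ^ (N + 1) ≤ B * (1 - 1 / t ^ N) / (t - 1) := by
    intro N
    induction N with
    | zero => simp
    | succ N ih =>
      rw [Finset.sum_range_succ]
      have e1 : ((N + 1 : ℕ) : ℝ) * (s (N + 1) / t ^ (N + 1 + 1))
          + ((N + 1 : ℕ) : ℝ) * τ (N + 1 + 1) / t ^ (N + 1 + 1)
          = N * τ (N + 1) / t ^ (N + 1) + τ (N + 1) / t ^ (N + 1) := by
        rw [hrec]
        push_cast
        field_simp
        ring
      have e2 : B * (1 - 1 / t ^ (N + 1)) / (t - 1)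
          = B * (1 - 1 / t ^ N) / (t - 1) + B / t ^ (N + 1) := by
        field_simp
        ring
      have e3 : τ (N + 1) / t ^ (N + 1) ≤ B / t ^ (N + 1) :=
        div_le_div_of_nonneg_right (hτ N) (by positivity)
      linarith
  rcases N with _ | N
  · simpa using div_nonneg hB h1.le
  · have h2 := key N
    have h3 : 0 ≤ (N : ℝ) * τ (N + 1) / t ^ (N + 1) :=
      div_nonneg (mul_nonneg N.cast_nonneg (hτ0 _)) (by positivity)
    have h4 : B * (1 - 1 / t ^ N) / (t - 1) ≤ B / (t - 1) := by
      apply div_le_div_of_nonneg_right _ h1.le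
      have : 0 ≤ B * (1 / t ^ N) := by positivity
      linarith
    linarith

/-- Every point of `[0, m/(q-1)]` has a `q`-expansion when `q ≤ m + 1`. -/
theorem exists_digitSum_eq {m : ℕ} {q : ℝ} (hq : 1 < q) (hqm : q ≤ m + 1) {y : ℝ}
    (hy : y ∈ Set.Icc 0 ((m : ℝ) / (q - 1))) :
    ∃ b : ℕ → ℕ, (∀ i, b i ≤ m) ∧ digitSum (fun i => (b i : ℝ)) q = y := by
  have h0 : (0 : ℝ) < q := by linarith
  have h1 : (0 : ℝ) < q - 1 := by linarith
  have step : ∀ z : Set.Icc (0 : ℝ) ((m : ℝ) / (q - 1)),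
      ∃ p : ℕ × Set.Icc (0 : ℝ) ((m : ℝ) / (q - 1)),
        p.1 ≤ m ∧ (z : ℝ) = (p.1 + p.2) / q := by
    rintro ⟨z, hz0, hz1⟩
    have hone : 1 ≤ (m : ℝ) / (q - 1) := by
      rw [le_div_iff₀ h1]
      linarith
    rw [le_div_iff₀ h1] at hz1
    by_cases hlt : q * z < m + 1
    · have hnn : 0 ≤ q * z := by positivity
      have hfl := Nat.floor_le hnn
      have hfl' := Nat.lt_floor_add_one (q * z)
      refine ⟨⟨⌊q * z⌋₊, ⟨q * z - ⌊q * z⌋₊, by linarith, by linarith⟩⟩, ?_, ?_⟩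
      · have : (⌊q * z⌋₊ : ℝ) < ((m + 1 : ℕ) : ℝ) := by push_cast; linarith
        exact Nat.lt_succ_iff.1 (by exact_mod_cast this)
      · simp [h0.ne']
    · push Not at hlt
      refine ⟨⟨m, ⟨q * z - m, by linarith, ?_⟩⟩, le_rfl, ?_⟩
      · rw [le_div_iff₀ h1]
        nlinarith
      · simp [h0.ne']
  choose g hg1 hg2 using step
  let w : ℕ → Set.Icc (0 : ℝ) ((m : ℝ) / (q - 1)) := fun n => (fun z => (g z).2)^[n] ⟨y, hy⟩
  have hw : ∀ n, w (n + 1) = (g (w n)).2 := fun n => Function.iterate_succ_apply' _ _ _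
  refine ⟨fun n => (g (w n)).1, fun n => hg1 _, ?_⟩
  have part : ∀ N : ℕ, ∑ i ∈ Finset.range N, ((g (w i)).1 : ℝ) / q ^ (i + 1)
      = y - (w N : ℝ) / q ^ N := by
    intro N
    induction N with
    | zero => simp [w]
    | succ N ih =>
      rw [Finset.sum_range_succ, ih, hw]
      have := hg2 (w N)
      rw [this]
      field_simp
      ring
  have hsum := (summable_digits_s9 (a := fun n => ((g (w n)).1 : ℝ)) (M := m) hq
    (fun i => Nat.cast_nonneg _) (fun i => by exact_mod_cast hg1 _)).hasSum.tendsto_sum_nat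
  have hlim : Filter.Tendsto (fun N => y - (w N : ℝ) / q ^ N) Filter.atTop (nhds y) := by
    have hz : Filter.Tendsto (fun N => (w N : ℝ) / q ^ N) Filter.atTop (nhds 0) := by
      have hgeo : Filter.Tendsto (fun N : ℕ => (m : ℝ) / (q - 1) * (1 / q) ^ N)
          Filter.atTop (nhds ((m : ℝ) / (q - 1) * 0)) :=
        (tendsto_pow_atTop_nhds_zero_of_lt_one (by positivity)
          ((div_lt_one h0).2 hq)).const_mul _
      rw [mul_zero] at hgeo
      refine squeeze_zero (fun N => div_nonneg (w N).2.1 (by positivity)) (fun N => ?_) hgeo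
      rw [one_div, inv_pow, ← div_eq_mul_inv]
      exact div_le_div_of_nonneg_right (w N).2.2 (by positivity)
    simpa using hz.const_sub y
  simp only [part] at hsum
  exact tendsto_nhds_unique hsum hlim

theorem mem_Uq'_iff {m : ℕ} {q : ℝ} {c : ℕ → ℕ} : c ∈ Uq' m q ↔ (∀ i, c i ≤ m) ∧
    ∀ d : ℕ → ℕ, (∀ i, d i ≤ m) →
      digitSum (fun i => (d i : ℝ)) q = digitSum (fun i => (c i : ℝ)) q → d = c := by
  constructor
  · rintro ⟨h, h'⟩
    exact ⟨h.1, fun d hd he => h' d ⟨hd, he.symm⟩⟩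
  · rintro ⟨h, h'⟩
    exact ⟨⟨h, rfl⟩, fun d hd => h' d hd.1 hd.2.symm⟩

theorem digitSum_cons {m : ℕ} {q : ℝ} (hq : 1 < q) {x : ℕ} {b : ℕ → ℕ} (hx : x ≤ m)
    (hb : ∀ i, b i ≤ m) :
    (∀ i, (fun n : ℕ => Nat.casesOn n x b : ℕ → ℕ) i ≤ m) ∧
    digitSum (fun i => (((fun n : ℕ => Nat.casesOn n x b : ℕ → ℕ) i : ℕ) : ℝ)) q
      = (x + digitSum (fun i => (b i : ℝ)) q) / q := by
  have h : ∀ i, (fun n : ℕ => Nat.casesOn n x b : ℕ → ℕ) i ≤ m := by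
    rintro (_ | i)
    · exact hx
    · exact hb i
  refine ⟨h, ?_⟩
  rw [digitSum_eq_shift (M := m) hq (fun i => Nat.cast_nonneg _) (fun i => by exact_mod_cast h i)]
  rfl

theorem shift_mem_Uq' {m : ℕ} {q : ℝ} (hq : 1 < q) (hqm : q ≤ m + 1) {c : ℕ → ℕ}
    (hc : c ∈ Uq' m q) (hlt : digitSum (fun i => (c i : ℝ)) q < 1) :
    (fun i => c (i + 1)) ∈ Uq' m q ∧ digitSum (fun i => (c (i + 1) : ℝ)) q < 1 := by
  obtain ⟨hcm, huniq⟩ := mem_Uq'_iff.1 hc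
  have h0 : (0 : ℝ) < q := by linarith
  have hs := digitSum_eq_shift (a := fun i => (c i : ℝ)) (M := m) hq
    (fun i => Nat.cast_nonneg _) (fun i => by exact_mod_cast hcm i)
  constructor
  · refine mem_Uq'_iff.2 ⟨fun i => hcm _, fun d hd he => ?_⟩
    obtain ⟨h1, h2⟩ := digitSum_cons hq (hcm 0) hd
    have := huniq _ h1 (by rw [h2, hs, he])
    funext i
    exact congrFun this (i + 1)
  · by_contra! hge
    rcases (hcm 0).lt_or_eq with hlt0 | heq
    · obtain ⟨b, hb, hby⟩ := exists_digitSum_eq hq hqm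
        (y := digitSum (fun i => (c (i + 1) : ℝ)) q - 1) ⟨by linarith, by
          have := digitSum_le_const (a := fun i => (c (i + 1) : ℝ)) (M := m) hq
            (fun i => Nat.cast_nonneg _) (fun i => by exact_mod_cast hcm _)
          linarith⟩
      obtain ⟨h1, h2⟩ := digitSum_cons hq (x := c 0 + 1) hlt0 hb
      have := huniq _ h1 (by rw [h2, hs, hby]; push_cast; ring)
      have h3 := congrFun this 0
      simp at h3
    · rw [hs, heq, div_lt_one h0] at hlt
      linarith

theorem digitSum_tail_lt_one {m : ℕ} {q : ℝ} (hq : 1 < q) (hqm : q ≤ m + 1) {c : ℕ → ℕ}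
    (hc : c ∈ Uq' m q) (hlt : digitSum (fun i => (c i : ℝ)) q < 1) (n : ℕ) :
    digitSum (fun i => (c (i + n) : ℝ)) q < 1 := by
  have : (fun i => c (i + n)) ∈ Uq' m q ∧ digitSum (fun i => (c (i + n) : ℝ)) q < 1 := by
    induction n with
    | zero => exact ⟨hc, hlt⟩
    | succ n ih =>
      have := shift_mem_Uq' hq hqm ih.1 ih.2
      simpa only [add_right_comm _ 1 n, add_assoc _ n 1] using this
  exact this.2

theorem summable_natCast_mul_digits {a : ℕ → ℝ} {M t : ℝ} (ht : 1 < t) (ha0 : ∀ i, 0 ≤ a i)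
    (ha : ∀ i, a i ≤ M) : Summable fun i : ℕ => (i : ℝ) * (a i / t ^ (i + 1)) := by
  have h0 : (0 : ℝ) < t := by linarith
  have hM : 0 ≤ M := (ha0 0).trans (ha 0)
  have hg : Summable fun i : ℕ => M / t * ((i : ℝ) ^ 1 * (1 / t) ^ i) := by
    have h1 : ‖1 / t‖ < 1 := by
      rw [Real.norm_of_nonneg (by positivity)]
      exact (div_lt_one h0).2 ht
    exact (summable_pow_mul_geometric_of_norm_lt_one 1 h1).mul_left (M / t)
  refine Summable.of_nonneg_of_le
    (fun i => mul_nonneg i.cast_nonneg (div_nonneg (ha0 i) (by positivity))) (fun i => ?_) hg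
  have : M / t * ((i : ℝ) ^ 1 * (1 / t) ^ i) = i * (M / t ^ (i + 1)) := by
    rw [one_div, inv_pow]
    field_simp
    ring
  rw [this]
  gcongr
  exact ha i

theorem hasDerivAt_digitSum_div {a : ℕ → ℝ} {M t : ℝ} (ht : 1 < t) (ha0 : ∀ i, 0 ≤ a i)
    (ha : ∀ i, a i ≤ M) :
    HasDerivAt (fun t => ∑' i : ℕ, a i / t ^ (i + 2))
      (-(2 * digitSum a t + ∑' i : ℕ, (i : ℝ) * (a i / t ^ (i + 1))) / t ^ 2) t := by
  obtain ⟨ρ, hρ1, hρt⟩ := exists_between ht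
  have h0 : (0 : ℝ) < t := by linarith
  have hρ0 : (0 : ℝ) < ρ := by linarith
  have hsum2 : ∀ {x : ℝ}, 1 < x →
      Summable fun i : ℕ => 2 * (a i / x ^ (i + 1)) + (i : ℝ) * (a i / x ^ (i + 1)) :=
    fun hx => ((summable_digits_s9 hx ha0 ha).mul_left 2).add
      (summable_natCast_mul_digits hx ha0 ha)
  have hu := (hsum2 hρ1).mul_right (1 / ρ ^ 2)
  have key := hasDerivAt_tsum_of_isPreconnected (t := Set.Ioi ρ) (y₀ := t) (y := t) hu
    isOpen_Ioi isPreconnected_Ioi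
    (g := fun i x => a i / x ^ (i + 2))
    (g' := fun i x => -((2 * (a i / x ^ (i + 1)) + (i : ℝ) * (a i / x ^ (i + 1))) * (1 / x ^ 2)))
    (fun i x hx => ?_) (fun i x hx => ?_) hρt ?_ hρt
  · refine key.congr_deriv ?_
    rw [tsum_neg, tsum_mul_right, ((summable_digits_s9 ht ha0 ha).mul_left 2).tsum_add
      (summable_natCast_mul_digits ht ha0 ha), tsum_mul_left, digitSum]
    ring
  · have hx0 : (0 : ℝ) < x := hρ0.trans hx
    have := ((hasDerivAt_pow (i + 2) x).fun_inv (by positivity)).const_mul (a i)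
    refine this.congr_deriv ?_
    push_cast
    field_simp
    simp
    ring
  · have hx0 : (0 : ℝ) < x := hρ0.trans hx
    have hx' : ρ ≤ x := le_of_lt hx
    have hai := ha0 i
    rw [norm_neg, Real.norm_of_nonneg (by positivity)]
    gcongr
  · have := (summable_digits_s9 ht ha0 ha).mul_right (1 / t)
    refine this.congr fun i => ?_
    rw [div_mul_div_comm, mul_one, ← pow_succ]

theorem base_inequality {k q t : ℝ} (hk : 1 ≤ k) (hq : k + 1 < q)
    (hqf : 0 ≤ q ^ 2 - (k + 1) * q - k) (hqt : q ≤ t) (ht : t ≤ 2 * k + 1) :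
    2 * k + 1 + 2 * (q / t * (2 * k / (q - 1) - 1)) + 2 * (q / t) / (t - 1)
      < 2 * k * t ^ 2 / (t - 1) ^ 2 := by
  obtain ⟨u, rfl⟩ : ∃ u, q = u + 1 := ⟨q - 1, by ring⟩
  obtain ⟨r, rfl⟩ : ∃ r, t = r + 1 := ⟨t - 1, by ring⟩
  obtain ⟨m, hm⟩ : ∃ m, m = 2 * k := ⟨_, rfl⟩
  have hu : 1 < u := by linarith
  have hur : u ≤ r := by linarith
  have hrm : r ≤ m := by linarith
  have hr0 : 0 < r := by linarith
  have hm2 : 2 ≤ m := by linarith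
  simp only [add_sub_cancel_right, ← hm] at hq hqf hqt ht ⊢
  have hend : 2 * m ^ 2 + (m ^ 2 - 4 * m + 1) * u - (2 * m - 2) * u ^ 2 < 0 := by
    by_cases h : u < m - 1 / 2
    · have h1 : m ≤ u ^ 2 - (k - 1) * u := by nlinarith
      nlinarith [mul_le_mul_of_nonneg_left h1 (by linarith : 0 ≤ 2 * m),
        mul_pos (by linarith : 0 < u) (by linarith : 0 < m - 1 / 2 - u)]
    · push Not at h
      have h1 : 0 ≤ (2 * m - 2) * u * (u - (m - 1 / 2)) := by
        apply mul_nonneg (mul_nonneg _ _) <;> linarith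
      have h2 : 2 * m < u * (m + 1) := by nlinarith
      nlinarith
  have hlin : m * u * r ^ 2 + (2 * m ^ 2 - 2 * m * u ^ 2 - m * u + u) * r
      + m * u * (2 * u - 3 * m) < 0 := by
    have h1 : m * u * r ^ 2 ≤ m * u * ((u + m) * r - u * m) := by
      apply mul_le_mul_of_nonneg_left _ (by positivity)
      nlinarith [mul_nonneg (sub_nonneg.2 hur) (sub_nonneg.2 hrm)]
    obtain ⟨σ, hσ⟩ : ∃ σ, σ = m * u * (u + m) + 2 * m ^ 2 - 2 * m * u ^ 2 - m * u + u := ⟨_, rfl⟩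
    have h2 : m * u * r ^ 2 + (2 * m ^ 2 - 2 * m * u ^ 2 - m * u + u) * r
        + m * u * (2 * u - 3 * m) ≤ σ * r - m ^ 2 * u ^ 2 + m * u * (2 * u - 3 * m) := by
      rw [hσ]
      nlinarith
    have hright : σ * m - m ^ 2 * u ^ 2 + m * u * (2 * u - 3 * m) < 0 := by
      have := mul_neg_of_pos_of_neg (by linarith : 0 < m) hend
      rw [hσ]
      nlinarith
    have hleft : σ * u - m ^ 2 * u ^ 2 + m * u * (2 * u - 3 * m) < 0 := by
      have h3 : -m * u ^ 2 + m * u - m ^ 2 + u < 0 := by nlinarith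
      have := mul_neg_of_pos_of_neg (by linarith : 0 < u) h3
      rw [hσ]
      nlinarith
    rcases le_total 0 σ with h | h
    · have := mul_le_mul_of_nonneg_left hrm h
      linarith
    · have := mul_le_mul_of_nonpos_left hur h
      linarith
  have hpoly : 2 * (u + 1) * (m - u) * r ^ 2 + 2 * (u + 1) * u * r + (m + 1) * (r + 1) * r ^ 2 * u
      - m * (r + 1) ^ 3 * u < 0 := by
    have h1 := mul_neg_of_pos_of_neg hr0 hlin
    have h2 : 0 ≤ u * (m - r) ^ 2 := by positivity
    refine neg_of_mul_neg_right (a := m) ?_ (by linarith)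
    nlinarith
  rw [← sub_neg]
  have hform : m + 1 + 2 * ((u + 1) / (r + 1) * (m / u - 1)) + 2 * ((u + 1) / (r + 1)) / r
      - m * (r + 1) ^ 2 / r ^ 2 = (2 * (u + 1) * (m - u) * r ^ 2 + 2 * (u + 1) * u * r
        + (m + 1) * (r + 1) * r ^ 2 * u - m * (r + 1) ^ 3 * u) / (u * r ^ 2 * (r + 1)) := by
    field_simp
    ring
  rw [hform]
  exact div_neg_of_neg_of_pos hpoly (by positivity)

theorem lt_largest_root {k x : ℝ} (hk : 0 < k)
    (hmax : ∀ y : ℝ, y ^ 2 - (k + 1) * y - k = 0 → y ≤ x) : k + 1 < x := by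
  have hD : 0 ≤ (k + 1) ^ 2 + 4 * k := by positivity
  have hs := Real.sq_sqrt hD
  have hlt : k + 1 < √((k + 1) ^ 2 + 4 * k) := Real.lt_sqrt_of_sq_lt (by linarith)
  have := hmax ((k + 1 + √((k + 1) ^ 2 + 4 * k)) / 2) (by linarith)
  linarith

/-- For even `m = 2k`: if `f_{c,d}(q) ≤ 0` with
`q ∈ [q_f(m), m+1]` and `c, d ∈ A'_q`, then `f_{c,d}` is strictly
increasing on `[q, m+1]`. -/
theorem stmt9 (k m : ℕ) (hk : 1 ≤ k) (hm : m = 2 * k) (qf : ℝ)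
    (hqf : qf ^ 2 - ((k : ℝ) + 1) * qf - (k : ℝ) = 0)
    (hqf' : ∀ y : ℝ, y ^ 2 - ((k : ℝ) + 1) * y - (k : ℝ) = 0 → y ≤ qf)
    (q : ℝ) (hq : q ∈ Set.Icc qf ((m : ℝ) + 1))
    (c d : ℕ → ℕ) (hc : c ∈ Aq' m q) (hd : d ∈ Aq' m q)
    (h0 : fcd m c d q ≤ 0) :
    StrictMonoOn (fcd m c d) (Set.Icc q ((m : ℝ) + 1)) := by
  have hk1 : (1 : ℝ) ≤ k := by exact_mod_cast hk
  have hmk : (m : ℝ) = 2 * k := by exact_mod_cast hm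
  have hqfk : (k : ℝ) + 1 < qf := lt_largest_root (by linarith) hqf'
  obtain ⟨hqfq, hqm⟩ := hq
  have hqk : (k : ℝ) + 1 < q := by linarith
  have hq1 : 1 < q := by linarith
  have hq0 : 0 < q := by linarith
  have hqpoly : 0 ≤ q ^ 2 - ((k : ℝ) + 1) * q - k := by nlinarith
  have hcm := (mem_Uq'_iff.1 hc.1).1
  have hdm := (mem_Uq'_iff.1 hd.1).1
  have hc0 : ∀ i, (0 : ℝ) ≤ c i := fun i => Nat.cast_nonneg _
  have hd0 : ∀ i, (0 : ℝ) ≤ d i := fun i => Nat.cast_nonneg _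
  have hcm' : ∀ i, (c i : ℝ) ≤ m := fun i => by exact_mod_cast hcm i
  have hdm' : ∀ i, (d i : ℝ) ≤ m := fun i => by exact_mod_cast hdm i
  obtain ⟨s, hs⟩ : ∃ s : ℕ → ℝ, s = fun i => (c i : ℝ) + d i := ⟨_, rfl⟩
  have hs0 : ∀ i, 0 ≤ s i := fun i => by rw [hs]; exact add_nonneg (hc0 i) (hd0 i)
  have hsm : ∀ i, s i ≤ 2 * m := fun i => by rw [hs]; linarith [hcm' i, hdm' i]
  have hfcd : ∀ t, fcd m c d t
      = ((m : ℝ) + 1) / t + (∑' i : ℕ, s i / t ^ (i + 2)) - (m : ℝ) / (t - 1) :=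
    fun t => by rw [hs, fcd]
  have hadd : ∀ n, digitSum (fun i => s (i + n)) q
      = digitSum (fun i => (c (i + n) : ℝ)) q + digitSum (fun i => (d (i + n) : ℝ)) q := by
    intro n
    rw [hs]
    unfold digitSum
    rw [← (summable_digits_s9 hq1 (fun i => hc0 _) fun i => hcm' (i + n)).tsum_add
      (summable_digits_s9 hq1 (fun i => hd0 _) fun i => hdm' (i + n))]
    exact tsum_congr fun i => add_div _ _ _
  have hX : digitSum s q ≤ m / (q - 1) - 1 := by
    have h1 : ∑' i : ℕ, s i / q ^ (i + 2) = digitSum s q / q := by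
      rw [digitSum, ← tsum_div_const]
      exact tsum_congr fun i => by rw [div_div, ← pow_succ]
    have h2 : ((m : ℝ) + 1) / q + digitSum s q / q - m / (q - 1)
        = (digitSum s q - (m / (q - 1) - 1)) / q := by
      have : q - 1 ≠ 0 := by linarith
      field_simp
      ring
    rw [hfcd, h1, h2] at h0
    by_contra! h
    exact absurd h0 (not_le.2 (div_pos (by linarith) hq0))
  have hlt : (m : ℝ) / (q - 1) - 1 < 1 := by
    rw [sub_lt_iff_lt_add, div_lt_iff₀ (by linarith)]
    linarith
  have htail : ∀ n, digitSum (fun i => s (i + n)) q ≤ 2 := by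
    intro n
    have h := hadd 0
    simp only [add_zero] at h
    have h1 := digitSum_nonneg hq0 hc0
    have h2 := digitSum_nonneg hq0 hd0
    have h3 := digitSum_tail_lt_one hq1 hqm hc.1 (by linarith) n
    have h4 := digitSum_tail_lt_one hq1 hqm hd.1 (by linarith) n
    linarith [hadd n]
  have hderiv : ∀ t ∈ Set.Icc q ((m : ℝ) + 1), ∃ y, 0 < y ∧ HasDerivAt (fcd m c d) y t := by
    rintro t ⟨hqt, htm⟩
    have ht1 : 1 < t := by linarith
    have ht0 : 0 < t := by linarith
    have hr0 : 0 < t - 1 := by linarith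
    refine ⟨-(m + 1) / t ^ 2
      + -(2 * digitSum s t + ∑' i : ℕ, (i : ℝ) * (s i / t ^ (i + 1))) / t ^ 2
      + m / (t - 1) ^ 2, ?_, ?_⟩
    · have hXt : digitSum s t ≤ q / t * (m / (q - 1) - 1) :=
        (digitSum_le_of_base_le hq1 hqt hs0 hsm).trans
          (mul_le_mul_of_nonneg_left hX (by positivity))
      have hW : ∑' i : ℕ, (i : ℝ) * (s i / t ^ (i + 1)) ≤ 2 * (q / t) / (t - 1) := by
        refine (summable_natCast_mul_digits ht1 hs0 hsm).tsum_le_of_sum_range_le fun N =>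
          sum_mul_digits_le (τ := fun n => digitSum (fun i => s (i + n)) t) ht1
            (fun n => ?_) (fun n => digitSum_nonneg ht0 fun i => hs0 _) (fun n => ?_) N
        · have h := digitSum_eq_shift (a := fun i => s (i + n)) ht1 (fun i => hs0 _)
            fun i => hsm _
          simp only [zero_add, add_right_comm _ 1 n] at h
          rw [eq_div_iff ht0.ne'] at h
          simp only [← add_assoc]
          linarith
        · have h := digitSum_le_of_base_le (a := fun i => s (i + (n + 1))) hq1 hqt
            (fun i => hs0 _) fun i => hsm _
          refine h.trans ?_
          rw [mul_comm]
          exact mul_le_mul_of_nonneg_right (htail _) (by positivity)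
      have hbase := base_inequality hk1 hqk hqpoly hqt (by linarith)
      rw [← hmk] at hbase
      have hpos : 0 < m * t ^ 2 / (t - 1) ^ 2 - (m + 1)
          - (2 * digitSum s t + ∑' i : ℕ, (i : ℝ) * (s i / t ^ (i + 1))) := by linarith
      have := div_pos hpos (by positivity : 0 < t ^ 2)
      refine this.trans_eq ?_
      field_simp
      ring
    · have h1 := (hasDerivAt_inv ht0.ne').const_mul ((m : ℝ) + 1)
      have h2 := hasDerivAt_digitSum_div ht1 hs0 hsm
      have h3 := (((hasDerivAt_id t).sub_const 1).fun_inv hr0.ne').const_mul (m : ℝ)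
      have h := (h1.add h2).sub h3
      rw [show fcd m c d = _ from funext hfcd]
      refine h.congr_deriv ?_
      simp only [id]
      field_simp
      ring
  refine strictMonoOn_of_deriv_pos (convex_Icc _ _) (fun t ht => ?_) fun t ht => ?_
  · obtain ⟨y, -, hy⟩ := hderiv t ht
    exact hy.continuousAt.continuousWithinAt
  · obtain ⟨y, hy0, hy⟩ := hderiv t (interior_subset ht)
    rwa [hy.deriv]
end
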